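/- In ℚ[x,y,z], let M be the 4×4 matrix equal to ½ times the matrix with rows (0, y, −x, 0), (y, −32z, −9y, 8x), (−x, −9y, 10x, 8z), (0, 8x, 8z, −8y). Then ¼·det M = (yz−x²)² − xy³. Equivalently, the determinant of the integer-coefficient matrix with those rows equals 64·((yz−x²)² − xy³). (This is the symmetric determinantal representation of the A₆-quartic adapted to the fourfold cover construction.) -/

import Mathlib

open MvPolynomial Matrix

namespace Stmt11

noncomputable section

def x : MvPolynomial (Fin 3) ℚ := X 0
def y : MvPolynomial (Fin 3) ℚ := X 1
def z : MvPolynomial (Fin 3) ℚ := X 2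

/-- The matrix `M`, one half times the displayed integral matrix. -/
def M : Matrix (Fin 4) (Fin 4) (MvPolynomial (Fin 3) ℚ) :=
  (C (1 / 2 : ℚ) : MvPolynomial (Fin 3) ℚ) •
    !![0, y, -x, 0;
       y, -32 * z, -9 * y, 8 * x;
       -x, -9 * y, 10 * x, 8 * z;
       0, 8 * x, 8 * z, -8 * y]

def xz : MvPolynomial (Fin 3) ℤ := X 0
def yz : MvPolynomial (Fin 3) ℤ := X 1
def zz : MvPolynomial (Fin 3) ℤ := X 2

/-- The integer-coefficient matrix `2M`. -/
def Mℤ : Matrix (Fin 4) (Fin 4) (MvPolynomial (Fin 3) ℤ) :=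
  !![0, yz, -xz, 0;
     yz, -32 * zz, -9 * yz, 8 * xz;
     -xz, -9 * yz, 10 * xz, 8 * zz;
     0, 8 * xz, 8 * zz, -8 * yz]

/-- The determinant of the symmetric matrix `2M` over an arbitrary commutative ring. -/
theorem det_symmetric_quartic {R : Type*} [CommRing R] (a b c : R) :
    det !![0, b, -a, 0;
           b, -32 * c, -9 * b, 8 * a;
           -a, -9 * b, 10 * a, 8 * c;
           0, 8 * a, 8 * c, -8 * b] =
      64 * ((b * c - a ^ 2) ^ 2 - a * b ^ 3) := by
  simp [det_succ_row_zero, Fin.sum_univ_succ, Fin.succAbove]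
  ring

/-- `¼·det M = (yz−x²)² − xy³`, and equivalently the determinant of the integral
matrix equals `64·((yz−x²)² − xy³)`. -/
theorem stmt11 :
    C (1 / 4 : ℚ) * M.det = (y * z - x ^ 2) ^ 2 - x * y ^ 3 ∧
    Mℤ.det = 64 * ((yz * zz - xz ^ 2) ^ 2 - xz * yz ^ 3) := by
  refine ⟨?_, det_symmetric_quartic xz yz zz⟩
  have hC : (C (1 / 4) * C (1 / 2) ^ 4 * 64 : MvPolynomial (Fin 3) ℚ) = 1 := by
    rw [← map_ofNat C 64, ← map_pow, ← map_mul, ← map_mul, ← C_1]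
    norm_num
  rw [M, det_smul, det_symmetric_quartic, Fintype.card_fin, ← mul_assoc, ← mul_assoc, hC, one_mul]

end

end Stmt11
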